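/- Let d ≥ 1 and k ≥ 0 be natural numbers, let K̂ ⊂ ℝ^d be a compact convex set with positive Lebesgue measure, and let ξ₁,…,ξ_n ∈ K̂ be unisolvent for degree k. Then there exists a constant C > 0, depending only on d, k, K̂ and the nodes, such that for every function f : ℝ^d → ℝ that is (k+1)-times continuously differentiable on an open neighborhood of K̂ and every polynomial P : ℝ^d → ℝ of total degree at most k satisfying P(ξᵢ) = f(ξᵢ) for all i: ‖f − P‖_{L²(K̂)} ≤ C sup_{x ∈ K̂} ‖D^{k+1} f(x)‖, where D^{k+1} f(x) denotes the (k+1)-st iterated Fréchet derivative of f at x with its operator norm. -/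

import Mathlib

open MeasureTheory Finset
open scoped ENNReal

/-- The restriction of a multilinear form to the diagonal, recentred at `a`, is a polynomial. -/
theorem MultilinearMap.exists_mvPolynomial_eval_sub {d m : ℕ}
    (A : MultilinearMap ℝ (fun _ : Fin m ↦ EuclideanSpace ℝ (Fin d)) ℝ)
    (a : EuclideanSpace ℝ (Fin d)) :
    ∃ p : MvPolynomial (Fin d) ℝ, p.totalDegree ≤ m ∧
      ∀ x : EuclideanSpace ℝ (Fin d), MvPolynomial.eval x p = A fun _ ↦ x - a := by
  classical
  let e : Fin d → EuclideanSpace ℝ (Fin d) := fun j ↦ EuclideanSpace.single j 1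
  refine ⟨∑ r : Fin m → Fin d, MvPolynomial.C (A fun i ↦ e (r i)) *
    ∏ i, (MvPolynomial.X (r i) - MvPolynomial.C (a (r i))), ?_, fun x ↦ ?_⟩
  · refine MvPolynomial.totalDegree_finsetSum_le fun r _ ↦ ?_
    refine (MvPolynomial.totalDegree_mul _ _).trans ?_
    rw [MvPolynomial.totalDegree_C, zero_add]
    refine (MvPolynomial.totalDegree_finsetProd _ _).trans ?_
    calc ∑ i, (MvPolynomial.X (r i) - MvPolynomial.C (a (r i)) :
            MvPolynomial (Fin d) ℝ).totalDegree ≤ ∑ _i : Fin m, 1 :=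
          Finset.sum_le_sum fun i _ ↦ (MvPolynomial.totalDegree_sub_C_le _ _).trans
            (MvPolynomial.totalDegree_X _).le
      _ = m := by simp
  · have hx : x - a = ∑ j, (x j - a j) • e j := by
      ext i
      simp [e, Finset.sum_apply, Pi.single_apply]
    rw [hx, A.map_sum]
    simp [MultilinearMap.map_smul_univ, mul_comm]

/-- If `f` is `C^{k+1}` along the segment from `a` to `x`, with `‖D^{k+1} f‖ ≤ M` there, then it is
within `M ‖x - a‖ ^ (k + 1)` of its Taylor sum at `a`. -/
theorem norm_sub_taylor_sum_le {E F : Type*} [NormedAddCommGroup E] [NormedSpace ℝ E]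
    [NormedAddCommGroup F] [NormedSpace ℝ F] [CompleteSpace F] {f : E → F} {a x : E} {k : ℕ} {M : ℝ}
    (hf : ∀ y ∈ segment ℝ a x, ContDiffAt ℝ (k + 1) f y)
    (hM : ∀ y ∈ segment ℝ a x, ‖iteratedFDeriv ℝ (k + 1) f y‖ ≤ M) :
    ‖f x - ∑ m ∈ range (k + 1), (m.factorial : ℝ)⁻¹ • iteratedFDeriv ℝ m f a fun _ ↦ x - a‖ ≤
      M * ‖x - a‖ ^ (k + 1) := by
  have hseg : ∀ t ∈ Set.Icc (0 : ℝ) 1, a + t • (x - a) ∈ segment ℝ a x := fun t ht ↦ by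
    rw [segment_eq_image']
    exact ⟨t, ht, rfl⟩
  have key := map_add_eq_sum_add_integral_iteratedFDeriv (f := f) (x := a) (y := x - a) (n := k)
    fun t ht ↦ hf _ (hseg t ht)
  rw [add_sub_cancel] at key
  rw [sub_eq_of_eq_add' key, norm_smul]
  have hM0 : 0 ≤ M := (norm_nonneg _).trans (hM a (left_mem_segment ℝ a x))
  have hfac : ‖(k.factorial : ℝ)⁻¹‖ ≤ 1 := by
    rw [norm_inv, Real.norm_natCast]
    exact inv_le_one_of_one_le₀ (mod_cast k.factorial_pos)
  have hint : ‖∫ t in (0 : ℝ)..1, (1 - t) ^ k •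
      iteratedFDeriv ℝ (k + 1) f (a + t • (x - a)) fun _ ↦ x - a‖ ≤ M * ‖x - a‖ ^ (k + 1) := by
    refine (intervalIntegral.norm_integral_le_of_norm_le_const
      (C := M * ‖x - a‖ ^ (k + 1)) fun t ht ↦ ?_).trans (by simp)
    rw [Set.uIoc_of_le zero_le_one] at ht
    rw [norm_smul, norm_pow]
    refine (mul_le_of_le_one_left (norm_nonneg _) (pow_le_one₀ (norm_nonneg _) ?_)).trans ?_
    · rw [Real.norm_eq_abs, abs_le]
      constructor <;> linarith [ht.1, ht.2]
    · refine (ContinuousMultilinearMap.le_opNorm _ _).trans ?_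
      rw [Finset.prod_const, Finset.card_univ, Fintype.card_fin]
      gcongr
      exact hM _ (hseg t ⟨ht.1.le, ht.2⟩)
  exact (mul_le_of_le_one_left (norm_nonneg _) hfac).trans hint

/-- Every polynomial of degree at most `k` is the combination of its nodal values with fixed
shape functions. -/
theorem exists_nodal_basis {d k n : ℕ} {ξ : Fin n → EuclideanSpace ℝ (Fin d)}
    (huni : ∀ p : MvPolynomial (Fin d) ℝ, p.totalDegree ≤ k →
      (∀ i, MvPolynomial.eval (ξ i) p = 0) → p = 0) :
    ∃ φ : Fin n → MvPolynomial (Fin d) ℝ, ∀ p : MvPolynomial (Fin d) ℝ, p.totalDegree ≤ k →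
      p = ∑ i, MvPolynomial.eval (ξ i) p • φ i := by
  let V := MvPolynomial.restrictTotalDegree (Fin d) ℝ k
  let N : V →ₗ[ℝ] Fin n → ℝ :=
    LinearMap.pi fun i ↦ (MvPolynomial.aeval (R := ℝ) (ξ i)).toLinearMap ∘ₗ V.subtype
  have hN : ∀ (p : V) i, N p i = MvPolynomial.eval (ξ i) (p : MvPolynomial (Fin d) ℝ) :=
    fun p i ↦ by simp [N, MvPolynomial.aeval_eq_eval]
  have hker : LinearMap.ker N = ⊥ := by
    refine LinearMap.ker_eq_bot'.2 fun p hp ↦ Subtype.ext ?_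
    refine huni p ((MvPolynomial.mem_restrictTotalDegree _ _ _).1 p.2) fun i ↦ ?_
    rw [← hN, hp, Pi.zero_apply]
  obtain ⟨L, hL⟩ := N.exists_leftInverse_of_injective hker
  refine ⟨fun i ↦ L (Pi.single i 1), fun p hp ↦ ?_⟩
  let q : V := ⟨p, (MvPolynomial.mem_restrictTotalDegree _ _ _).2 hp⟩
  have hq : L (N q) = q := LinearMap.congr_fun hL q
  rw [pi_eq_sum_univ' (N q), map_sum] at hq
  have := congrArg (Subtype.val : V → MvPolynomial (Fin d) ℝ) hq
  simpa [hN, q, eq_comm] using this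

theorem continuous_eval_euclidean {d : ℕ} (p : MvPolynomial (Fin d) ℝ) :
    Continuous fun x : EuclideanSpace ℝ (Fin d) ↦ MvPolynomial.eval x p :=
  (MvPolynomial.continuous_eval p).comp (PiLp.continuous_ofLp 2 _)

/-- Unisolvent nodes control polynomials of degree at most `k` uniformly on compact sets. -/
theorem exists_abs_eval_le_of_unisolvent {d k n : ℕ} {K : Set (EuclideanSpace ℝ (Fin d))}
    (hK : IsCompact K) {ξ : Fin n → EuclideanSpace ℝ (Fin d)}
    (huni : ∀ p : MvPolynomial (Fin d) ℝ, p.totalDegree ≤ k →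
      (∀ i, MvPolynomial.eval (ξ i) p = 0) → p = 0) :
    ∃ Λ : ℝ, 0 ≤ Λ ∧ ∀ p : MvPolynomial (Fin d) ℝ, p.totalDegree ≤ k → ∀ B : ℝ,
      (∀ i, |MvPolynomial.eval (ξ i) p| ≤ B) → ∀ x ∈ K, |MvPolynomial.eval x p| ≤ Λ * B := by
  obtain ⟨φ, hφ⟩ := exists_nodal_basis huni
  choose c hc using fun i ↦
    hK.exists_bound_of_continuousOn (continuous_eval_euclidean (φ i)).continuousOn
  refine ⟨∑ i, |c i|, by positivity, fun p hp B hB x hx ↦ ?_⟩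
  rw [congrArg (MvPolynomial.eval x) (hφ p hp), map_sum, Finset.sum_mul]
  refine (Finset.abs_sum_le_sum_abs _ _).trans (Finset.sum_le_sum fun i _ ↦ ?_)
  rw [MvPolynomial.smul_eval, abs_mul, mul_comm]
  exact mul_le_mul ((hc i x hx).trans (le_abs_self _)) (hB i) (abs_nonneg _) (abs_nonneg _)

theorem ContDiffOn.le_biSup_norm_iteratedFDeriv {E F : Type*} [NormedAddCommGroup E]
    [NormedSpace ℝ E] [NormedAddCommGroup F] [NormedSpace ℝ F] {f : E → F} {K U : Set E} {m : ℕ}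
    (hf : ContDiffOn ℝ m f U) (hK : IsCompact K) (hU : IsOpen U) (hKU : K ⊆ U) {y : E}
    (hy : y ∈ K) : ‖iteratedFDeriv ℝ m f y‖ ≤ ⨆ x ∈ K, ‖iteratedFDeriv ℝ m f x‖ := by
  have hcont : ContinuousOn (iteratedFDeriv ℝ m f) K := fun z hz ↦
    ((hf.contDiffAt (hU.mem_nhds (hKU hz))).iteratedFDeriv_right
      (i := m) (m := 0) (by simp)).continuousAt.continuousWithinAt
  obtain ⟨c, hc⟩ := hK.exists_bound_of_continuousOn hcont
  have hc0 : 0 ≤ c := (norm_nonneg _).trans (hc y hy)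
  have hbdd : BddAbove (Set.range fun x ↦ ⨆ _ : x ∈ K, ‖iteratedFDeriv ℝ m f x‖) := by
    refine ⟨c, ?_⟩
    rintro _ ⟨x, rfl⟩
    exact Real.iSup_le (hc x) hc0
  refine le_trans ?_ (le_ciSup hbdd y)
  simp [hy]

/-- A uniform bound on a set of finite measure gives an `L²` bound. -/
theorem sqrt_setIntegral_sq_le {α : Type*} [MeasurableSpace α] {μ : Measure α} {s : Set α}
    (hs : μ s < ∞) {g : α → ℝ} {B : ℝ} (hB : 0 ≤ B) (hg : ∀ x ∈ s, |g x| ≤ B) :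
    Real.sqrt (∫ x in s, g x ^ 2 ∂μ) ≤ Real.sqrt (μ.real s) * B := by
  rw [Real.sqrt_le_left (by positivity), mul_pow, Real.sq_sqrt measureReal_nonneg, mul_comm]
  refine (Real.le_norm_self _).trans (norm_setIntegral_le_of_norm_le_const hs fun x hx ↦ ?_)
  rw [norm_pow]
  exact pow_le_pow_left₀ (norm_nonneg _) (hg x hx) 2

/-- Reference-element interpolation error estimate: for `f` of class `C^{k+1}` on an open
neighborhood of the compact convex set `K̂` and `P` its degree-`k` Lagrange nodal
interpolant at unisolvent nodes, `‖f − P‖_{L²(K̂)} ≤ C sup_{x∈K̂} ‖D^{k+1}f(x)‖`. -/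
theorem ref_element_interpolation_error
    (d k n : ℕ) (hd : 1 ≤ d)
    (Khat : Set (EuclideanSpace ℝ (Fin d)))
    (hcomp : IsCompact Khat) (hconv : Convex ℝ Khat) (hpos : 0 < volume Khat)
    (ξ : Fin n → EuclideanSpace ℝ (Fin d)) (hξ : ∀ i, ξ i ∈ Khat)
    (huni : ∀ p : MvPolynomial (Fin d) ℝ, p.totalDegree ≤ k →
      (∀ i, MvPolynomial.eval (ξ i) p = 0) → p = 0) :
    ∃ C : ℝ, 0 < C ∧
      ∀ (f : EuclideanSpace ℝ (Fin d) → ℝ) (U : Set (EuclideanSpace ℝ (Fin d))),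
        IsOpen U → Khat ⊆ U → ContDiffOn ℝ (k + 1 : ℕ) f U →
      ∀ (P : MvPolynomial (Fin d) ℝ), P.totalDegree ≤ k →
        (∀ i, MvPolynomial.eval (ξ i) P = f (ξ i)) →
        Real.sqrt (∫ x in Khat, (f x - MvPolynomial.eval x P) ^ 2) ≤
          C * ⨆ x ∈ Khat, ‖iteratedFDeriv ℝ (k + 1) f x‖ := by
  obtain ⟨a, ha⟩ : Khat.Nonempty := nonempty_of_measure_ne_zero hpos.ne'
  obtain ⟨Λ, hΛ, hstab⟩ := exists_abs_eval_le_of_unisolvent (k := k) hcomp huni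
  set R := Metric.diam Khat ^ (k + 1)
  have hR0 : 0 ≤ R := pow_nonneg Metric.diam_nonneg _
  refine ⟨Real.sqrt (volume.real Khat) * ((1 + Λ) * R) + 1, by positivity,
    fun f U hU hKU hf P hP hPf ↦ ?_⟩
  set M := ⨆ x ∈ Khat, ‖iteratedFDeriv ℝ (k + 1) f x‖
  have hM : ∀ y ∈ Khat, ‖iteratedFDeriv ℝ (k + 1) f y‖ ≤ M := fun y hy ↦
    hf.le_biSup_norm_iteratedFDeriv hcomp hU hKU hy
  have hM0 : 0 ≤ M := (norm_nonneg _).trans (hM a ha)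
  choose q hqdeg hq using fun m ↦
    (iteratedFDeriv ℝ m f a).toMultilinearMap.exists_mvPolynomial_eval_sub a
  let T : MvPolynomial (Fin d) ℝ := ∑ m ∈ range (k + 1), (m.factorial : ℝ)⁻¹ • q m
  have hT : T.totalDegree ≤ k := MvPolynomial.totalDegree_finsetSum_le fun m hm ↦
    (MvPolynomial.totalDegree_smul_le _ _).trans
      ((hqdeg m).trans (Nat.lt_succ_iff.1 (Finset.mem_range.1 hm)))
  have htaylor : ∀ x ∈ Khat, |f x - MvPolynomial.eval x T| ≤ R * M := fun x hx ↦ by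
    have hseg := hconv.segment_subset ha hx
    have h := norm_sub_taylor_sum_le (f := f) (a := a) (x := x) (k := k) (M := M)
      (fun y hy ↦ by exact_mod_cast hf.contDiffAt (hU.mem_nhds (hKU (hseg hy))))
      fun y hy ↦ hM y (hseg hy)
    have hdist : ‖x - a‖ ≤ Metric.diam Khat := by
      rw [← dist_eq_norm]
      exact Metric.dist_le_diam_of_mem hcomp.isBounded hx ha
    have heval : MvPolynomial.eval x T = ∑ m ∈ range (k + 1),
        (m.factorial : ℝ)⁻¹ • iteratedFDeriv ℝ m f a fun _ ↦ x - a := by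
      simp [T, map_sum, MvPolynomial.smul_eval, hq]
    rw [heval, mul_comm]
    exact h.trans (mul_le_mul_of_nonneg_left (pow_le_pow_left₀ (norm_nonneg _) hdist _) hM0)
  have hnodes : ∀ i, |MvPolynomial.eval (ξ i) (T - P)| ≤ R * M := fun i ↦ by
    rw [map_sub, hPf, abs_sub_comm]
    exact htaylor _ (hξ i)
  have hTP := hstab (T - P) ((MvPolynomial.totalDegree_sub _ _).trans (max_le hT hP)) _ hnodes
  have hbound : ∀ x ∈ Khat, |f x - MvPolynomial.eval x P| ≤ (1 + Λ) * R * M := fun x hx ↦ by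
    have h := abs_add_le (f x - MvPolynomial.eval x T) (MvPolynomial.eval x (T - P))
    rw [map_sub, sub_add_sub_cancel, ← map_sub] at h
    linarith [htaylor x hx, hTP x hx]
  refine (sqrt_setIntegral_sq_le hcomp.measure_lt_top (by positivity) hbound).trans ?_
  linarith
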